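/- arXiv:0906.2461 — 7 statements merged into one kernel-verified Lean document; each statement's English description precedes it below -/
import Mathlib

section
/- Let Q and Q' be convex bodies in ℝ³ such that the interior of Q is contained in the interior of Q', and let p and q be points lying on both the frontier of Q and the frontier of Q'. Then the intrinsic distance between p and q within the frontier of Q' is greater than or equal to the intrinsic distance between p and q within the frontier of Q. -/
theorem convex_proj_exists {E : Type*} [NormedAddCommGroup E] [InnerProductSpace ℝ E]
    (K : Set E) (hne : K.Nonempty) (hc : IsComplete K) (hconv : Convex ℝ K) :
    ∃ f : E → E, LipschitzWith 1 f ∧ (∀ x, f x ∈ K) ∧ (∀ x ∈ K, f x = x) ∧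
      ∀ x, f x ∈ interior K → f x = x := by
  have h : ∀ x : E, ∃ v ∈ K, ∀ w ∈ K, inner ℝ (x - v) (w - v) ≤ 0 := by
    intro x
    obtain ⟨v, hv, hv'⟩ := exists_norm_eq_iInf_of_complete_convex hne hc hconv x
    exact ⟨v, hv, (norm_eq_iInf_iff_real_inner_le_zero hconv hv).1 hv'⟩
  choose f hf hin using h
  refine ⟨f, ?_, hf, ?_, ?_⟩
  · refine LipschitzWith.of_dist_le_mul fun x y => ?_
    rw [dist_eq_norm, dist_eq_norm, NNReal.coe_one, one_mul]
    have h1 := hin x (f y) (hf y)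
    have h2 := hin y (f x) (hf x)
    have h3 : inner ℝ (x - y) (f x - f y) - inner ℝ (f x - f y) (f x - f y)
        = - inner ℝ (x - f x) (f y - f x) - inner ℝ (y - f y) (f x - f y) := by
      simp only [inner_sub_left, inner_sub_right]
      ring
    have h4 := real_inner_le_norm (x - y) (f x - f y)
    rw [real_inner_self_eq_norm_mul_norm] at h3
    by_contra! hlt
    have := norm_nonneg (x - y)
    nlinarith
  · intro x hx
    have h1 := hin x x hx
    exact (sub_eq_zero.1 ((inner_self_eq_zero (𝕜 := ℝ)).1 (le_antisymm h1 real_inner_self_nonneg))).symm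
  · intro x hx
    have hcont : Filter.Tendsto (fun t : ℝ => f x + t • (x - f x)) (nhdsWithin 0 (Set.Ioi 0))
        (nhds (f x)) := by
      have : Continuous (fun t : ℝ => f x + t • (x - f x)) := by fun_prop
      have h0 := this.tendsto 0
      simp only [zero_smul, add_zero] at h0
      exact h0.mono_left nhdsWithin_le_nhds
    have hev := hcont.eventually (mem_interior_iff_mem_nhds.1 hx)
    obtain ⟨t, ht, ht0⟩ := (hev.and self_mem_nhdsWithin).exists
    have h1 := hin x _ ht
    rw [add_sub_cancel_left, inner_smul_right] at h1
    have ht0' : 0 < t := ht0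
    have h2 : inner ℝ (x - f x) (x - f x) ≤ 0 := by
      by_contra! hlt
      have := mul_pos ht0' hlt
      linarith
    exact (sub_eq_zero.1 ((inner_self_eq_zero (𝕜 := ℝ)).1 (le_antisymm h2 real_inner_self_nonneg))).symm


/-- The intrinsic distance between `p` and `q` within a set `S ⊆ ℝ³`: the infimum of
lengths (`eVariationOn` over `[0,1]`) of continuous paths in `S` from `p` to `q`. -/
noncomputable def intrinsicPathDist (S : Set (EuclideanSpace ℝ (Fin 3)))
    (p q : EuclideanSpace ℝ (Fin 3)) : ENNReal :=
  ⨅ γ ∈ {γ : ℝ → EuclideanSpace ℝ (Fin 3) |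
      ContinuousOn γ (Set.Icc 0 1) ∧ γ 0 = p ∧ γ 1 = q ∧
      Set.MapsTo γ (Set.Icc 0 1) S},
    eVariationOn γ (Set.Icc (0 : ℝ) 1)

/-- Growing lemma: if the interior of a convex body `Q` is contained in the interior of a
convex body `Q'`, and `p, q` lie on both frontiers, then the intrinsic distance between
`p` and `q` within the frontier of `Q'` is at least that within the frontier of `Q`. -/
theorem growing_lemma (Q Q' : Set (EuclideanSpace ℝ (Fin 3)))
    (hQc : IsCompact Q) (hQconv : Convex ℝ Q) (hQint : (interior Q).Nonempty)
    (hQ'c : IsCompact Q') (hQ'conv : Convex ℝ Q') (hQ'int : (interior Q').Nonempty)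
    (hsub : interior Q ⊆ interior Q')
    (p q : EuclideanSpace ℝ (Fin 3))
    (hpQ : p ∈ frontier Q) (hpQ' : p ∈ frontier Q')
    (hqQ : q ∈ frontier Q) (hqQ' : q ∈ frontier Q') :
    intrinsicPathDist (frontier Q) p q ≤ intrinsicPathDist (frontier Q') p q := by
  obtain ⟨f, hf, hfK, hfix, hint⟩ := convex_proj_exists Q (hQint.mono interior_subset)
    hQc.isComplete hQconv
  unfold intrinsicPathDist
  refine le_iInf₂ fun γ hγ => ?_
  obtain ⟨hcont, h0, h1, hmaps⟩ := hγ
  refine (iInf₂_le (f ∘ γ) ⟨?_, ?_, ?_, ?_⟩).trans ?_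
  · simpa using (hf.lipschitzOnWith (s := Set.univ)).comp_eVariationOn_le
      (Set.mapsTo_univ γ (Set.Icc (0 : ℝ) 1))
  · exact hf.continuous.comp_continuousOn hcont
  · simp [h0, hfix p (hQc.isClosed.frontier_subset hpQ)]
  · simp [h1, hfix q (hQc.isClosed.frontier_subset hqQ)]
  · intro t ht
    refine ⟨subset_closure (hfK _), fun hi => ?_⟩
    have he := hint _ hi
    have hi' : γ t ∈ interior Q := by
      rw [← he]
      exact hi
    exact (hmaps ht).2 (hsub hi')
end

section
/- For a convex body Q in ℝ³ and points p, q on the frontier of Q, the intrinsic distance between p and q within the frontier of Q is equal to the intrinsic distance between p and q within the complement of the interior of Q. -/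
/-- For a convex body `Q` in ℝ³ and points `p, q` on its frontier, the intrinsic distance
between `p` and `q` within the frontier of `Q` equals the intrinsic distance between them
within the complement of the interior of `Q`. -/
theorem intrinsicPathDist_frontier_eq_compl_interior
    (Q : Set (EuclideanSpace ℝ (Fin 3)))
    (hQc : IsCompact Q) (hQconv : Convex ℝ Q) (hQint : (interior Q).Nonempty)
    (p q : EuclideanSpace ℝ (Fin 3))
    (hp : p ∈ frontier Q) (hq : q ∈ frontier Q) :
    intrinsicPathDist (frontier Q) p q = intrinsicPathDist (interior Q)ᶜ p q := by
  have hnp : ∀ v : EuclideanSpace ℝ (Fin 3), inner ℝ v v ≤ 0 → v = 0 := by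
    intro v hv
    rw [real_inner_self_eq_norm_sq] at hv
    exact norm_eq_zero.1 (pow_eq_zero_iff two_ne_zero |>.1 (le_antisymm hv (sq_nonneg _)))
  have hne : Q.Nonempty := hQint.mono interior_subset
  have hex : ∀ x : EuclideanSpace ℝ (Fin 3), ∃ v ∈ Q, ∀ w ∈ Q, inner ℝ (x - v) (w - v) ≤ 0 := by
    intro x
    obtain ⟨v, hv, h⟩ := exists_norm_eq_iInf_of_complete_convex hne hQc.isComplete hQconv x
    exact ⟨v, hv, (norm_eq_iInf_iff_real_inner_le_zero hQconv hv).1 h⟩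
  choose P hPQ hP using hex
  have hfix : ∀ x ∈ Q, P x = x := by
    intro x hx
    exact (sub_eq_zero.1 (hnp _ (hP x x hx))).symm
  have hlip : LipschitzWith 1 P := by
    apply LipschitzWith.of_dist_le_mul
    intro x y
    rw [dist_eq_norm, dist_eq_norm, NNReal.coe_one, one_mul]
    have h1 := hP x (P y) (hPQ y)
    have h2 := hP y (P x) (hPQ x)
    have h3 : inner ℝ (P x - P y) (P x - P y) ≤ inner ℝ (x - y) (P x - P y) := by
      simp only [inner_sub_left, inner_sub_right] at h1 h2 ⊢
      linarith
    have h4 := real_inner_le_norm (x - y) (P x - P y)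
    rw [real_inner_self_eq_norm_sq] at h3
    by_contra! hlt
    have := norm_nonneg (x - y)
    nlinarith
  have hfr : ∀ x ∈ (interior Q)ᶜ, P x ∈ frontier Q := by
    intro x hx
    rw [hQc.isClosed.frontier_eq]
    refine ⟨hPQ x, fun hi => ?_⟩
    have ht : Filter.Tendsto (fun ε : ℝ => P x + ε • (x - P x)) (nhdsWithin 0 (Set.Ioi 0))
        (nhds (P x)) := by
      have hc : Continuous (fun ε : ℝ => P x + ε • (x - P x)) := by fun_prop
      have := hc.tendsto 0
      simp only [zero_smul, add_zero] at this
      exact this.mono_left nhdsWithin_le_nhds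
    obtain ⟨ε, hε, hε0⟩ :=
      ((ht.eventually (mem_interior_iff_mem_nhds.1 hi)).and self_mem_nhdsWithin).exists
    have h := hP x _ hε
    rw [add_sub_cancel_left, inner_smul_right] at h
    have h' : inner ℝ (x - P x) (x - P x) ≤ 0 := nonpos_of_mul_nonpos_right h hε0
    have hxe := sub_eq_zero.1 (hnp _ h')
    rw [← hxe] at hi
    exact hx hi
  have hsub : frontier Q ⊆ (interior Q)ᶜ := by
    rw [hQc.isClosed.frontier_eq]
    exact fun x hx => hx.2
  have hfQ : frontier Q ⊆ Q := hQc.isClosed.frontier_subset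
  apply le_antisymm
  · refine le_iInf₂ fun γ hγ => ?_
    obtain ⟨hc, h0, h1, hm⟩ := hγ
    have hle : eVariationOn (P ∘ γ) (Set.Icc 0 1) ≤ eVariationOn γ (Set.Icc (0 : ℝ) 1) := by
      simpa using (hlip.lipschitzOnWith (s := Set.univ)).comp_eVariationOn_le
        (Set.mapsTo_univ γ (Set.Icc (0 : ℝ) 1))
    refine le_trans (iInf₂_le (P ∘ γ) ⟨hlip.continuous.comp_continuousOn hc, ?_, ?_, ?_⟩) hle
    · simp [h0, hfix p (hfQ hp)]
    · simp [h1, hfix q (hfQ hq)]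
    · exact fun t ht => hfr _ (hm ht)
  · refine le_iInf₂ fun γ hγ => ?_
    obtain ⟨hc, h0, h1, hm⟩ := hγ
    exact iInf₂_le γ ⟨hc, h0, h1, fun t ht => hsub (hm ht)⟩
end

section
/- Let Q be a convex body in ℝ³ and let p, q lie on the frontier of Q. Suppose γ : ℝ → ℝ³ is continuous on [0,1], maps [0,1] into the complement of the interior of Q, satisfies γ 0 = p and γ 1 = q, and its length eVariationOn γ (Set.Icc 0 1) is finite and equal to the intrinsic distance between p and q within the complement of the interior of Q. Then γ maps [0,1] into the frontier of Q. -/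
/-- A shortest 3D path between two boundary points of a convex body avoiding its interior
as an obstacle lies entirely on the surface of the body. -/
theorem shortest_path_avoiding_interior_lies_on_frontier
    (Q : Set (EuclideanSpace ℝ (Fin 3)))
    (hQc : IsCompact Q) (hQconv : Convex ℝ Q) (hQint : (interior Q).Nonempty)
    (p q : EuclideanSpace ℝ (Fin 3))
    (hp : p ∈ frontier Q) (hq : q ∈ frontier Q)
    (γ : ℝ → EuclideanSpace ℝ (Fin 3))
    (hγcont : ContinuousOn γ (Set.Icc 0 1))
    (hγmaps : Set.MapsTo γ (Set.Icc 0 1) (interior Q)ᶜ)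
    (hγ0 : γ 0 = p) (hγ1 : γ 1 = q)
    (hfin : eVariationOn γ (Set.Icc (0 : ℝ) 1) ≠ ⊤)
    (hlen : eVariationOn γ (Set.Icc (0 : ℝ) 1) = intrinsicPathDist (interior Q)ᶜ p q) :
    Set.MapsTo γ (Set.Icc 0 1) (frontier Q) := by
  intro t₀ ht₀
  have hQcl : IsClosed Q := hQc.isClosed
  have hfr : frontier Q = Q \ interior Q := hQcl.frontier_eq
  rw [hfr] at hp hq ⊢
  refine ⟨?_, hγmaps ht₀⟩
  by_contra hx
  obtain ⟨f, u, hfQ, hfx⟩ := geometric_hahn_banach_closed_point hQconv hQcl hx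
  have hfc : ContinuousOn (fun t => f (γ t)) (Set.Icc 0 1) := f.continuous.comp_continuousOn hγcont
  have h0 : f (γ 0) < u := hγ0 ▸ hfQ p hp.1
  have h1 : f (γ 1) < u := hγ1 ▸ hfQ q hq.1
  obtain ⟨a, ⟨ha0, hat⟩, hfa⟩ := intermediate_value_Icc (f := fun t => f (γ t)) ht₀.1
    (hfc.mono (Set.Icc_subset_Icc le_rfl ht₀.2)) ⟨h0.le, hfx.le⟩
  obtain ⟨b, ⟨htb, hb1⟩, hfb⟩ := intermediate_value_Icc' (f := fun t => f (γ t)) ht₀.2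
    (hfc.mono (Set.Icc_subset_Icc ht₀.1 le_rfl)) ⟨h1.le, hfx.le⟩
  simp only at hfa hfb
  have hat' : a < t₀ := lt_of_le_of_ne hat (by rintro rfl; linarith)
  have htb' : t₀ < b := lt_of_le_of_ne htb (by rintro rfl; linarith)
  have hab : a < b := hat'.trans htb'
  have ha0' : 0 < a := lt_of_le_of_ne ha0 (by rintro rfl; linarith)
  have hb1' : b < 1 := lt_of_le_of_ne hb1 (by rintro rfl; linarith)
  set s : ℝ → EuclideanSpace ℝ (Fin 3) :=
    fun t => AffineMap.lineMap (γ a) (γ b) ((t - a) / (b - a)) with hs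
  have hsa : s a = γ a := by simp [hs]
  have hsb : s b = γ b := by simp [hs, div_self (sub_pos.2 hab).ne']
  have hscont : Continuous s := by
    rw [hs]; simp only [AffineMap.lineMap_apply_module]; fun_prop
  have hsf : ∀ t, f (s t) = u := by
    intro t
    simp only [hs, AffineMap.lineMap_apply_module, map_add, map_smul, hfa, hfb, smul_eq_mul]
    ring
  have hsvar : eVariationOn s (Set.Icc a b) ≤ edist (γ a) (γ b) := by
    have hl : LipschitzWith (nndist (γ a) (γ b))
        (AffineMap.lineMap (γ a) (γ b) : ℝ → EuclideanSpace ℝ (Fin 3)) :=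
      lipschitzWith_lineMap (γ a) (γ b)
    have hm : Monotone (fun t : ℝ => (t - a) / (b - a)) := fun x y hxy => by
      have := sub_pos.2 hab
      simp only
      gcongr
    have h2 := (hl.lipschitzOnWith (s := Set.univ)).comp_eVariationOn_le
      (g := fun t : ℝ => (t - a) / (b - a)) (s := Set.Icc a b) (Set.mapsTo_univ _ _)
    have h3 := (hm.monotoneOn (Set.Icc a b)).eVariationOn_le
      (Set.left_mem_Icc.2 hab.le) (Set.right_mem_Icc.2 hab.le)
    simp only [Set.inter_self, sub_self, zero_div, sub_zero, div_self (sub_pos.2 hab).ne',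
      ENNReal.ofReal_one] at h3
    calc _ ≤ _ := h2
      _ ≤ (nndist (γ a) (γ b) : ENNReal) * 1 := by gcongr
      _ = _ := by rw [mul_one, edist_nndist]
  have hstrict : edist (γ a) (γ b) < eVariationOn γ (Set.Icc a b) := by
    have e1 : edist (γ a) (γ t₀) ≤ eVariationOn γ (Set.Icc a t₀) :=
      eVariationOn.edist_le _ (Set.left_mem_Icc.2 hat) (Set.right_mem_Icc.2 hat)
    have e2 : edist (γ t₀) (γ b) ≤ eVariationOn γ (Set.Icc t₀ b) :=
      eVariationOn.edist_le _ (Set.left_mem_Icc.2 htb) (Set.right_mem_Icc.2 htb)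
    have e3 := eVariationOn.Icc_add_Icc γ (s := Set.univ) hat htb (Set.mem_univ _)
    simp only [Set.univ_inter] at e3
    rw [← e3]
    refine lt_of_lt_of_le ?_ (add_le_add e1 e2)
    rw [edist_dist, edist_dist, edist_dist, ← ENNReal.ofReal_add dist_nonneg dist_nonneg]
    have hd : dist (γ a) (γ b) < dist (γ a) (γ t₀) + dist (γ t₀) (γ b) := by
      refine lt_of_le_of_ne (dist_triangle _ _ _) fun h => ?_
      obtain ⟨r, -, hr⟩ := dist_add_dist_eq_iff.1 h.symm
      have : f (γ t₀) = u := by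
        rw [← hr]
        simp only [AffineMap.lineMap_apply_module, map_add, map_smul, hfa, hfb, smul_eq_mul]
        ring
      linarith
    exact (ENNReal.ofReal_lt_ofReal_iff (dist_nonneg.trans_lt hd)).2 hd
  classical
  set γ' : ℝ → EuclideanSpace ℝ (Fin 3) := (Set.Icc a b).piecewise s γ with hγ'
  have q2 : Set.EqOn γ' s (Set.Icc a b) := fun t ht => Set.piecewise_eq_of_mem _ _ _ ht
  have q1 : Set.EqOn γ' γ (Set.Icc 0 a) := fun t ht => by
    rcases ht.2.eq_or_lt with rfl | h
    · rw [q2 (Set.left_mem_Icc.2 hab.le), hsa]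
    · exact Set.piecewise_eq_of_notMem _ _ _ (fun h' => absurd h'.1 (not_le.2 h))
  have q3 : Set.EqOn γ' γ (Set.Icc b 1) := fun t ht => by
    rcases ht.1.eq_or_lt with rfl | h
    · rw [q2 (Set.right_mem_Icc.2 hab.le), hsb]
    · exact Set.piecewise_eq_of_notMem _ _ _ (fun h' => absurd h'.2 (not_le.2 h))
  have add3 : ∀ g : ℝ → EuclideanSpace ℝ (Fin 3), eVariationOn g (Set.Icc 0 1) =
      eVariationOn g (Set.Icc 0 a) + eVariationOn g (Set.Icc a b)
        + eVariationOn g (Set.Icc b 1) := fun g => by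
    have e1 := eVariationOn.Icc_add_Icc g (s := Set.univ) ha0 hab.le (Set.mem_univ _)
    have e2 := eVariationOn.Icc_add_Icc g (s := Set.univ) (ha0.trans hab.le) hb1 (Set.mem_univ _)
    simp only [Set.univ_inter] at e1 e2
    rw [e1, e2]
  have hcont' : ContinuousOn γ' (Set.Icc 0 1) := by
    have c1 : ContinuousOn γ' (Set.Icc 0 a) :=
      (hγcont.mono (Set.Icc_subset_Icc le_rfl (hab.le.trans hb1))).congr q1
    have c2 : ContinuousOn γ' (Set.Icc a b) := hscont.continuousOn.congr q2
    have c3 : ContinuousOn γ' (Set.Icc b 1) :=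
      (hγcont.mono (Set.Icc_subset_Icc (ha0.trans hab.le) le_rfl)).congr q3
    have := (c1.union_of_isClosed c2 isClosed_Icc isClosed_Icc).union_of_isClosed c3
      (isClosed_Icc.union isClosed_Icc) isClosed_Icc
    rwa [Set.Icc_union_Icc_eq_Icc ha0 hab.le, Set.Icc_union_Icc_eq_Icc (ha0.trans hab.le) hb1] at this
  have hmaps' : Set.MapsTo γ' (Set.Icc 0 1) (interior Q)ᶜ := fun t ht => by
    by_cases h : t ∈ Set.Icc a b
    · rw [q2 h]
      intro hi
      have := hfQ _ (interior_subset hi)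
      rw [hsf] at this
      exact lt_irrefl _ this
    · rw [hγ', Set.piecewise_eq_of_notMem _ _ _ h]
      exact hγmaps ht
  have hle : intrinsicPathDist (interior Q)ᶜ p q ≤ eVariationOn γ' (Set.Icc 0 1) :=
    iInf₂_le γ' ⟨hcont', by rw [q1 (Set.left_mem_Icc.2 ha0), hγ0],
      by rw [q3 (Set.right_mem_Icc.2 hb1), hγ1], hmaps'⟩
  rw [← hlen, add3 γ, add3 γ', eVariationOn.congr q1, eVariationOn.congr q2,
    eVariationOn.congr q3] at hle
  rw [add3 γ] at hfin
  simp only [ne_eq, ENNReal.add_eq_top, not_or] at hfin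
  refine absurd hle (not_le.2 ?_)
  exact ENNReal.add_lt_add_right hfin.2
    (ENNReal.add_lt_add_left hfin.1.1 (hsvar.trans_lt hstrict))
end

section
/- Let Q be a convex body in ℝ³ and let p, q lie on the frontier of Q. Then the intrinsic distance between p and q within the frontier of Q is finite, and there exists a map γ : ℝ → ℝ³, continuous on [0,1], with γ 0 = p, γ 1 = q, γ([0,1]) contained in the frontier of Q, and eVariationOn γ (Set.Icc 0 1) equal to this intrinsic distance. -/
open Set Filter Topology in
theorem aux_reparam {E : Type*} [MetricSpace E] {γ : ℝ → E} {C : NNReal}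
    (hc : ContinuousOn γ (Icc 0 1)) (hv : eVariationOn γ (Icc (0:ℝ) 1) ≤ C) :
    ∃ x : ℝ → ℝ, (∀ u, x u ∈ Icc (0:ℝ) 1) ∧ LipschitzWith C (γ ∘ x) ∧ γ (x 0) = γ 0 ∧
      γ (x 1) = γ 1 ∧ eVariationOn (γ ∘ x) (Icc (0:ℝ) 1) ≤ eVariationOn γ (Icc (0:ℝ) 1) := by
  have h0 : (0:ℝ) ∈ Icc (0:ℝ) 1 := by simp
  have h1 : (1:ℝ) ∈ Icc (0:ℝ) 1 := by simp
  have hb : BoundedVariationOn γ (Icc (0:ℝ) 1) := ne_top_of_le_ne_top (by simp) hv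
  have hl := hb.locallyBoundedVariationOn
  set s : ℝ → ℝ := variationOnFromTo γ (Icc 0 1) 0 with hs
  have hadd : ∀ x ∈ Icc (0:ℝ) 1, ∀ y ∈ Icc (0:ℝ) 1,
      s y - s x = variationOnFromTo γ (Icc 0 1) x y := by
    intro x hx y hy
    have := variationOnFromTo.add hl h0 hx hy
    simp only [hs]; linarith
  have hmono : MonotoneOn s (Icc 0 1) := variationOnFromTo.monotoneOn hl h0
  have hs0 : s 0 = 0 := variationOnFromTo.self _ _ _
  have hs1 : s 1 ≤ C := by
    simp only [hs]
    rw [variationOnFromTo.eq_of_le _ _ zero_le_one, inter_self]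
    exact ENNReal.toReal_le_of_le_ofReal C.2 (by simpa using hv)
  have hs1' : 0 ≤ s 1 := variationOnFromTo.nonneg_of_le _ _ zero_le_one
  have hdist : ∀ x ∈ Icc (0:ℝ) 1, ∀ y ∈ Icc (0:ℝ) 1, dist (γ x) (γ y) ≤ |s x - s y| := by
    have key : ∀ x ∈ Icc (0:ℝ) 1, ∀ y ∈ Icc (0:ℝ) 1, x ≤ y → dist (γ x) (γ y) ≤ |s x - s y| := by
      intro x hx y hy hxy
      rw [abs_sub_comm, hadd x hx y hy, variationOnFromTo.eq_of_le _ _ hxy]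
      refine le_trans ?_ (le_abs_self _)
      exact (hl x y hx hy).dist_le ⟨hx, by simp [hxy]⟩ ⟨hy, by simp [hxy]⟩
    intro x hx y hy
    rcases le_total x y with h | h
    · exact key x hx y hy h
    · rw [dist_comm, abs_sub_comm]; exact key y hy x hx h
  have hcont : ContinuousOn s (Icc 0 1) := by
    intro x hx
    have t1 := hb.tendsto_eVariationOn_Icc_zero_left ((hc x hx).mono (s := Icc 0 1 ∩ Iic x) inter_subset_left)
    have t2 := hb.tendsto_eVariationOn_Icc_zero_right x ((hc x hx).mono (s := Icc 0 1 ∩ Ici x) inter_subset_left)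
    have t3 := ((ENNReal.tendsto_toReal ENNReal.zero_ne_top).comp t1).add
      ((ENNReal.tendsto_toReal ENNReal.zero_ne_top).comp t2)
    simp only [ENNReal.toReal_zero, add_zero] at t3
    unfold ContinuousWithinAt
    rw [tendsto_iff_dist_tendsto_zero]
    refine squeeze_zero' (Eventually.of_forall fun _ => dist_nonneg) ?_ t3
    filter_upwards [self_mem_nhdsWithin] with y hy
    rw [Real.dist_eq, hadd x hx y hy]
    simp only [Function.comp]
    rcases le_total x y with h | h
    · rw [variationOnFromTo.eq_of_le _ _ h, abs_of_nonneg ENNReal.toReal_nonneg]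
      exact le_add_of_nonneg_left ENNReal.toReal_nonneg
    · rw [variationOnFromTo.eq_of_ge _ _ h, abs_neg, abs_of_nonneg ENNReal.toReal_nonneg]
      exact le_add_of_nonneg_right ENNReal.toReal_nonneg
  have hivt : ∀ u : ℝ, ∃ x ∈ Icc (0:ℝ) 1, s x = s 1 * (projIcc (0:ℝ) 1 zero_le_one u : ℝ) := by
    intro u
    have hu := (projIcc (0:ℝ) 1 zero_le_one u).2
    have := intermediate_value_Icc zero_le_one hcont
    apply this
    rw [hs0]
    exact ⟨mul_nonneg hs1' hu.1, mul_le_of_le_one_right hs1' hu.2⟩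
  choose x hx hxs using hivt
  refine ⟨x, hx, ?_, ?_, ?_, ?_⟩
  · refine LipschitzWith.of_dist_le_mul fun u v => ?_
    refine (hdist _ (hx u) _ (hx v)).trans ?_
    rw [hxs, hxs, ← mul_sub, abs_mul, abs_of_nonneg hs1']
    gcongr
    have := (LipschitzWith.projIcc (zero_le_one (α := ℝ))).dist_le_mul u v
    simpa [Subtype.dist_eq, Real.dist_eq] using this
  · have := hdist _ (hx 0) _ h0
    rw [hxs] at this
    simpa [hs0] using this
  · have := hdist _ (hx 1) _ h1
    rw [hxs] at this
    simpa using this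
  · by_cases hz : s 1 = 0
    · have : eVariationOn (γ ∘ x) (Icc (0:ℝ) 1) = 0 := by
        rw [eVariationOn.eq_zero_iff]
        intro a _ b _
        have := hdist _ (hx a) _ (hx b)
        rw [hxs, hxs] at this
        rw [edist_dist]
        simpa [hz] using this
      simp [this]
    · apply eVariationOn.comp_le_of_monotoneOn _ _ _ (fun u _ => hx u)
      intro u hu v hv huv
      rcases huv.eq_or_lt with rfl | huv
      · rfl
      by_contra! hlt
      have := hmono (hx v) (hx u) hlt.le
      rw [hxs, hxs, projIcc_of_mem _ hu, projIcc_of_mem _ hv] at this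
      have := le_of_mul_le_mul_left this (lt_of_le_of_ne hs1' (Ne.symm hz))
      simp at this; linarith

open Set Filter Topology in
theorem aux_path {s : Set (EuclideanSpace ℝ (Fin 3))} (hs : IsCompact s) (hconv : Convex ℝ s)
    (h0 : s ∈ 𝓝 0) {p q : EuclideanSpace ℝ (Fin 3)} (hp : p ∈ frontier s) (hq : q ∈ frontier s) :
    ∃ (γ : ℝ → EuclideanSpace ℝ (Fin 3)) (C : NNReal), LipschitzOnWith C γ (Icc 0 1) ∧
      γ 0 = p ∧ γ 1 = q ∧ MapsTo γ (Icc 0 1) (frontier s) := by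
  have gf : ∀ x, gauge s x = 1 ↔ x ∈ frontier s := fun x =>
    gauge_eq_one_iff_mem_frontier hconv h0
  have hgp := (gf p).2 hp
  have hgq := (gf q).2 hq
  have hp0 : p ≠ 0 := by rintro rfl; simp at hgp
  have hq0 : q ≠ 0 := by rintro rfl; simp at hgq
  obtain ⟨w, hw⟩ : ∃ w, w ∉ Submodule.span ℝ ({p, q} : Set (EuclideanSpace ℝ (Fin 3))) := by
    by_contra! h
    have htop : Submodule.span ℝ ({p, q} : Set (EuclideanSpace ℝ (Fin 3))) = ⊤ :=
      Submodule.eq_top_iff'.2 h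
    classical
    have h2 := finrank_span_finset_le_card (R := ℝ) ({p, q} : Finset (EuclideanSpace ℝ (Fin 3)))
    have h3 := Finset.card_le_two (a := p) (b := q)
    rw [Set.finrank] at h2
    rw [Finset.coe_pair] at h2
    rw [htop, finrank_top, finrank_euclideanSpace_fin] at h2
    omega
  let c : ℝ → EuclideanSpace ℝ (Fin 3) := fun t => (1 - t) • p + t • q + (t * (1 - t)) • w
  have hc0 : ∀ t, c t ≠ 0 := by
    intro t ht
    have hm : (t * (1 - t)) • w ∈ Submodule.span ℝ ({p, q} : Set (EuclideanSpace ℝ (Fin 3))) := by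
      have : (t * (1 - t)) • w = -((1 - t) • p + t • q) := by
        rw [eq_neg_iff_add_eq_zero, add_comm]; exact ht
      rw [this]
      refine Submodule.neg_mem _ (Submodule.add_mem _ (Submodule.smul_mem _ _ (Submodule.subset_span (by simp)))
        (Submodule.smul_mem _ _ (Submodule.subset_span (by simp))))
    have hz : t * (1 - t) = 0 := by
      by_contra hne
      exact hw ((Submodule.smul_mem_iff _ hne).1 hm)
    rcases mul_eq_zero.1 hz with h | h
    · simp [c, h] at ht; exact hp0 ht
    · have : t = 1 := by linarith
      simp [c, this] at ht; exact hq0 ht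
  have hcc : Continuous c := by fun_prop
  have hgc : Continuous (gauge s) := continuous_gauge hconv h0
  have hpos : ∀ t, 0 < gauge s (c t) := fun t =>
    (gauge_pos (absorbent_nhds_zero h0) (NormedSpace.isVonNBounded_iff ℝ |>.2 hs.isBounded)).2 (hc0 t)
  have hcI : IsCompact (Icc (0:ℝ) 1) := isCompact_Icc
  obtain ⟨t0, -, ht0⟩ := hcI.exists_isMinOn ⟨0, by simp⟩ (hgc.comp hcc).continuousOn
  obtain ⟨t1, -, ht1⟩ := hcI.exists_isMaxOn ⟨0, by simp⟩ hcc.norm.continuousOn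
  obtain ⟨K, hK⟩ := hconv.lipschitz_gauge h0
  set m := gauge s (c t0) with hm
  set M := ‖c t1‖ with hM
  have hm0 : 0 < m := hpos t0
  have hM0 : 0 ≤ M := norm_nonneg _
  have hcl : ∀ x ∈ Icc (0:ℝ) 1, ∀ y ∈ Icc (0:ℝ) 1, ‖c x - c y‖ ≤ (‖q - p‖ + ‖w‖) * |x - y| := by
    intro x hx y hy
    have : c x - c y = (x - y) • ((q - p) + (1 - x - y) • w) := by
      simp only [c]; module
    rw [this, norm_smul, Real.norm_eq_abs, mul_comm]
    gcongr
    refine (norm_add_le _ _).trans ?_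
    gcongr
    rw [norm_smul]
    refine mul_le_of_le_one_left (norm_nonneg _) ?_
    rw [Real.norm_eq_abs, abs_le]
    constructor <;> linarith [hx.1, hx.2, hy.1, hy.2]
  refine ⟨fun t => (gauge s (c t))⁻¹ • c t,
    Real.toNNReal ((m⁻¹ + m⁻¹ * m⁻¹ * K * M) * (‖q - p‖ + ‖w‖)), ?_, ?_, ?_, ?_⟩
  · refine LipschitzOnWith.of_dist_le_mul fun x hx y hy => ?_
    rw [Real.coe_toNNReal _ (by positivity), dist_eq_norm, Real.dist_eq, mul_assoc]
    have hgx : m ≤ gauge s (c x) := ht0 hx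
    have hgy : m ≤ gauge s (c y) := ht0 hy
    have hny : ‖c y‖ ≤ M := ht1 hy
    have hix : (gauge s (c x))⁻¹ ≤ m⁻¹ := inv_anti₀ hm0 hgx
    have hiy : (gauge s (c y))⁻¹ ≤ m⁻¹ := inv_anti₀ hm0 hgy
    have hxp := hpos x
    have hyp := hpos y
    have hd : |gauge s (c y) - gauge s (c x)| ≤ K * ‖c x - c y‖ := by
      have := hK.dist_le_mul (c x) (c y)
      rwa [Real.dist_eq, abs_sub_comm, dist_eq_norm] at this
    have e : (gauge s (c x))⁻¹ • c x - (gauge s (c y))⁻¹ • c y =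
        (gauge s (c x))⁻¹ • (c x - c y) +
        ((gauge s (c x))⁻¹ * (gauge s (c y))⁻¹ * (gauge s (c y) - gauge s (c x))) • c y := by
      have : (gauge s (c x))⁻¹ * (gauge s (c y))⁻¹ * (gauge s (c y) - gauge s (c x)) =
        (gauge s (c x))⁻¹ - (gauge s (c y))⁻¹ := by field_simp
      rw [this]; module
    rw [e]
    calc _ ≤ (gauge s (c x))⁻¹ * ‖c x - c y‖ + (gauge s (c x))⁻¹ * (gauge s (c y))⁻¹ *
          |gauge s (c y) - gauge s (c x)| * ‖c y‖ := by
          refine (norm_add_le _ _).trans (le_of_eq ?_)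
          rw [norm_smul, norm_smul, Real.norm_eq_abs, Real.norm_eq_abs, abs_mul, abs_mul,
            abs_of_pos (inv_pos.2 hxp), abs_of_pos (inv_pos.2 hyp)]
      _ ≤ m⁻¹ * ‖c x - c y‖ + m⁻¹ * m⁻¹ * (K * ‖c x - c y‖) * M := by gcongr
      _ = (m⁻¹ + m⁻¹ * m⁻¹ * K * M) * ‖c x - c y‖ := by ring
      _ ≤ _ := by gcongr; exact hcl x hx y hy
  · simp [c, hgp]
  · simp [c, hgq]
  · intro t _
    rw [← gf, gauge_smul_of_nonneg (inv_nonneg.2 (hpos t).le), smul_eq_mul, inv_mul_cancel₀ (hpos t).ne']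

open Set Filter Topology in
theorem aux_path' {Q : Set (EuclideanSpace ℝ (Fin 3))} (hs : IsCompact Q) (hconv : Convex ℝ Q)
    (hi : (interior Q).Nonempty) {p q : EuclideanSpace ℝ (Fin 3)}
    (hp : p ∈ frontier Q) (hq : q ∈ frontier Q) :
    ∃ (γ : ℝ → EuclideanSpace ℝ (Fin 3)) (C : NNReal), LipschitzOnWith C γ (Icc 0 1) ∧
      γ 0 = p ∧ γ 1 = q ∧ MapsTo γ (Icc 0 1) (frontier Q) := by
  obtain ⟨a, ha⟩ := hi
  let h := Homeomorph.addLeft a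
  have hf : h ⁻¹' (frontier Q) = frontier (h ⁻¹' Q) := h.preimage_frontier Q
  obtain ⟨γ, C, h1, h2, h3, h4⟩ := aux_path (s := h ⁻¹' Q) (h.isCompact_preimage.2 hs)
    (hconv.translate_preimage_right a)
    (h.continuous.continuousAt.preimage_mem_nhds (by simpa [h] using mem_interior_iff_mem_nhds.1 ha))
    (p := -a + p) (q := -a + q) (by rw [← hf]; simpa [h] using hp) (by rw [← hf]; simpa [h] using hq)
  refine ⟨fun t => a + γ t, C, ?_, by simp [h2], by simp [h3], fun t ht => ?_⟩
  · intro x hx y hy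
    simpa using h1 hx hy
  · have := h4 ht
    rw [← hf] at this
    exact this



/-- On the frontier of a convex body in ℝ³, the intrinsic distance between any two points
is finite and is attained by some shortest path. -/
theorem exists_shortest_path_on_frontier
    (Q : Set (EuclideanSpace ℝ (Fin 3)))
    (hQc : IsCompact Q) (hQconv : Convex ℝ Q) (hQint : (interior Q).Nonempty)
    (p q : EuclideanSpace ℝ (Fin 3))
    (hp : p ∈ frontier Q) (hq : q ∈ frontier Q) :
    intrinsicPathDist (frontier Q) p q ≠ ⊤ ∧
    ∃ γ : ℝ → EuclideanSpace ℝ (Fin 3),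
      ContinuousOn γ (Set.Icc 0 1) ∧ γ 0 = p ∧ γ 1 = q ∧
      Set.MapsTo γ (Set.Icc 0 1) (frontier Q) ∧
      eVariationOn γ (Set.Icc (0 : ℝ) 1) = intrinsicPathDist (frontier Q) p q := by
  classical
  obtain ⟨γ₀, C₀, hl₀, h00, h01, hm₀⟩ := aux_path' hQc hQconv hQint hp hq
  have hfin : intrinsicPathDist (frontier Q) p q ≠ ⊤ := by
    have hb : eVariationOn γ₀ (Set.Icc (0:ℝ) 1) ≠ ⊤ := by
      have := hl₀.locallyBoundedVariationOn 0 1 (by simp) (by simp)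
      rwa [Set.inter_self] at this
    refine ne_top_of_le_ne_top hb ?_
    exact iInf₂_le γ₀ ⟨hl₀.continuousOn, h00, h01, hm₀⟩
  refine ⟨hfin, ?_⟩
  set L := intrinsicPathDist (frontier Q) p q with hL
  obtain ⟨C, hC⟩ : ∃ C : NNReal, (C : ENNReal) = L + 1 :=
    ⟨(L + 1).toNNReal, ENNReal.coe_toNNReal (by simp [hfin])⟩
  have hLC : L < C := by rw [hC]; exact ENNReal.lt_add_right hfin one_ne_zero
  let K : Set (ℝ → EuclideanSpace ℝ (Fin 3)) :=
    {f | (∀ x, f x ∈ frontier Q) ∧ (∀ x y, dist (f x) (f y) ≤ C * dist x y) ∧ f 0 = p ∧ f 1 = q}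
  have hfc : IsCompact (frontier Q) := hQc.of_isClosed_subset isClosed_frontier hQc.isClosed.frontier_subset
  have hKc : IsCompact K := by
    refine (isCompact_univ_pi (fun _ : ℝ => hfc)).of_isClosed_subset ?_ (fun f hf x _ => hf.1 x)
    refine IsClosed.inter (s₁ := {f : ℝ → EuclideanSpace ℝ (Fin 3) | ∀ x, f x ∈ frontier Q}) ?_
      (IsClosed.inter (s₁ := {f : ℝ → EuclideanSpace ℝ (Fin 3) | ∀ x y, dist (f x) (f y) ≤ C * dist x y}) ?_
      (IsClosed.inter (s₁ := {f : ℝ → EuclideanSpace ℝ (Fin 3) | f 0 = p})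
        (s₂ := {f : ℝ → EuclideanSpace ℝ (Fin 3) | f 1 = q}) ?_ ?_))
    · simp only [Set.ofPred_forall]
      exact isClosed_iInter fun x => isClosed_frontier.preimage (continuous_apply x)
    · simp only [Set.ofPred_forall]
      exact isClosed_iInter fun x => isClosed_iInter fun y =>
        isClosed_le ((continuous_apply x).dist (continuous_apply y)) continuous_const
    · exact isClosed_eq (continuous_apply _) continuous_const
    · exact isClosed_eq (continuous_apply _) continuous_const
  have hred : ∀ γ : ℝ → EuclideanSpace ℝ (Fin 3), ContinuousOn γ (Set.Icc 0 1) → γ 0 = p →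
      γ 1 = q → Set.MapsTo γ (Set.Icc 0 1) (frontier Q) → eVariationOn γ (Set.Icc (0:ℝ) 1) ≤ C →
      ∃ f ∈ K, eVariationOn f (Set.Icc (0:ℝ) 1) ≤ eVariationOn γ (Set.Icc (0:ℝ) 1) := by
    intro γ h1 h2 h3 h4 h5
    obtain ⟨x, hx, hl, hx0, hx1, hv⟩ := aux_reparam h1 h5
    exact ⟨γ ∘ x, ⟨fun u => h4 (hx u), fun u v => hl.dist_le_mul u v, hx0.trans h2, hx1.trans h3⟩, hv⟩
  obtain ⟨γ₁, ⟨a1, a2, a3, a4⟩, hγ₁⟩ : ∃ γ ∈ {γ : ℝ → EuclideanSpace ℝ (Fin 3) |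
      ContinuousOn γ (Set.Icc 0 1) ∧ γ 0 = p ∧ γ 1 = q ∧
      Set.MapsTo γ (Set.Icc 0 1) (frontier Q)}, eVariationOn γ (Set.Icc (0:ℝ) 1) < C := by
    have := hLC
    rw [hL] at this
    unfold intrinsicPathDist at this
    simpa only [iInf_lt_iff, exists_prop] using this
  obtain ⟨f₁, hf₁, hf₁v⟩ := hred γ₁ a1 a2 a3 a4 hγ₁.le
  have hlsc : LowerSemicontinuousOn
      (fun f : ℝ → EuclideanSpace ℝ (Fin 3) => eVariationOn f (Set.Icc (0:ℝ) 1)) K := by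
    intro f _ v hv
    refine eVariationOn.lowerSemicontinuous_aux (F := fun g : ℝ → EuclideanSpace ℝ (Fin 3) => g) (fun x _ => ?_) hv
    exact ((continuous_apply x).tendsto f).mono_left nhdsWithin_le_nhds
  obtain ⟨f, hfK, hfmin⟩ := hlsc.exists_isMinOn ⟨f₁, hf₁⟩ hKc
  have hfl : LipschitzWith C f := LipschitzWith.of_dist_le_mul hfK.2.1
  refine ⟨f, hfl.continuous.continuousOn, hfK.2.2.1, hfK.2.2.2, fun x _ => hfK.1 x, le_antisymm ?_ ?_⟩
  · refine le_iInf₂ fun γ hγ => ?_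
    rcases le_total (eVariationOn γ (Set.Icc (0:ℝ) 1)) C with h | h
    · obtain ⟨g, hg, hgv⟩ := hred γ hγ.1 hγ.2.1 hγ.2.2.1 hγ.2.2.2 h
      exact (hfmin hg).trans hgv
    · exact ((hfmin hf₁).trans (hf₁v.trans hγ₁.le)).trans h
  · exact iInf₂_le f ⟨hfl.continuous.continuousOn, hfK.2.2.1, hfK.2.2.2, fun x _ => hfK.1 x⟩
end

section
/- Let Q and Q̃ be convex bodies in ℝ³ with the interior of Q contained in the interior of Q̃. Let γ : ℝ → ℝ³ be continuous on [0,1] with γ 0 = p, γ 1 = q, with γ([0,1]) contained in the frontier of Q, and with eVariationOn γ (Set.Icc 0 1) equal to the intrinsic distance between p and q within the frontier of Q. If moreover γ([0,1]) is contained in the frontier of Q̃, then eVariationOn γ (Set.Icc 0 1) equals the intrinsic distance between p and q within the frontier of Q̃; that is, γ remains a shortest path on the grown body Q̃. -/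
open Set in
theorem exists_proj_aux (Q : Set (EuclideanSpace ℝ (Fin 3)))
    (hQc : IsCompact Q) (hQconv : Convex ℝ Q) (hne : Q.Nonempty) :
    ∃ P : EuclideanSpace ℝ (Fin 3) → EuclideanSpace ℝ (Fin 3),
      LipschitzWith 1 P ∧ (∀ x ∈ Q, P x = x) ∧ ∀ x, x ∉ interior Q → P x ∈ frontier Q := by
  have h : ∀ x, ∃ v ∈ Q, ∀ w ∈ Q, inner ℝ (x - v) (w - v) ≤ 0 := by
    intro x
    obtain ⟨v, hv, h⟩ := exists_norm_eq_iInf_of_complete_convex hne hQc.isComplete hQconv x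
    exact ⟨v, hv, (norm_eq_iInf_iff_real_inner_le_zero hQconv hv).1 h⟩
  choose P hP hin using h
  refine ⟨P, ?_, ?_, ?_⟩
  · refine LipschitzWith.of_dist_le_mul fun x y => ?_
    rw [NNReal.coe_one, one_mul, dist_eq_norm, dist_eq_norm]
    have h1 := hin x (P y) (hP y)
    have h2 := hin y (P x) (hP x)
    have h3 : inner ℝ (x - y) (P x - P y) - inner ℝ (P x - P y) (P x - P y)
        = - inner ℝ (x - P x) (P y - P x) - inner ℝ (y - P y) (P x - P y) := by
      rw [← neg_sub (P x) (P y), inner_neg_right, neg_neg, ← inner_sub_left, ← inner_sub_left]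
      congr 1
      abel
    have h4 := real_inner_le_norm (x - y) (P x - P y)
    rw [real_inner_self_eq_norm_sq] at h3
    by_contra hlt
    push Not at hlt
    nlinarith [norm_nonneg (x - y), norm_nonneg (P x - P y)]
  · intro x hx
    have h1 := hin x x hx
    exact (sub_eq_zero.1 (real_inner_self_nonpos.1 h1)).symm
  · intro x hx
    refine ⟨subset_closure (hP x), fun hi => hx ?_⟩
    have hc : Filter.Tendsto (fun t : ℝ => P x + t • (x - P x)) (nhdsWithin 0 (Ioi 0))
        (nhds (P x)) := by
      have : Continuous (fun t : ℝ => P x + t • (x - P x)) := by fun_prop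
      have h0 := this.tendsto 0
      simp only [zero_smul, add_zero] at h0
      exact h0.mono_left nhdsWithin_le_nhds
    have hev := hc.eventually (isOpen_interior.mem_nhds hi)
    obtain ⟨t, ht, ht0⟩ := (hev.and self_mem_nhdsWithin).exists
    have h1 := hin x _ (interior_subset ht)
    rw [add_sub_cancel_left, inner_smul_right] at h1
    have h2 : inner ℝ (x - P x) (x - P x) ≤ 0 := by
      by_contra hh
      push Not at hh
      exact absurd h1 (not_le.2 (mul_pos ht0 hh))
    rw [sub_eq_zero.1 (real_inner_self_nonpos.1 h2)]
    exact hi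

/-- A shortest path on the frontier of a convex body `Q` that also lies on the frontier of
a grown convex body `Q̃` (whose interior contains that of `Q`) remains a shortest path on
the frontier of `Q̃`. -/
theorem shortest_path_remains_shortest_on_grown_body
    (Q Qt : Set (EuclideanSpace ℝ (Fin 3)))
    (hQc : IsCompact Q) (hQconv : Convex ℝ Q) (hQint : (interior Q).Nonempty)
    (hQtc : IsCompact Qt) (hQtconv : Convex ℝ Qt) (hQtint : (interior Qt).Nonempty)
    (hsub : interior Q ⊆ interior Qt)
    (p q : EuclideanSpace ℝ (Fin 3))
    (γ : ℝ → EuclideanSpace ℝ (Fin 3))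
    (hγcont : ContinuousOn γ (Set.Icc 0 1))
    (hγ0 : γ 0 = p) (hγ1 : γ 1 = q)
    (hγQ : Set.MapsTo γ (Set.Icc 0 1) (frontier Q))
    (hγshort : eVariationOn γ (Set.Icc (0 : ℝ) 1) = intrinsicPathDist (frontier Q) p q)
    (hγQt : Set.MapsTo γ (Set.Icc 0 1) (frontier Qt)) :
    eVariationOn γ (Set.Icc (0 : ℝ) 1) = intrinsicPathDist (frontier Qt) p q := by
  apply le_antisymm
  · obtain ⟨P, hL, hfix, hfr⟩ := exists_proj_aux Q hQc hQconv (hQint.mono interior_subset)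
    rw [hγshort]
    have hmem : ∀ t ∈ Set.Icc (0 : ℝ) 1, γ t ∈ Q := fun t ht =>
      hQc.isClosed.frontier_subset (hγQ ht)
    have hp : p ∈ Q := hγ0 ▸ hmem 0 (by simp)
    have hq : q ∈ Q := hγ1 ▸ hmem 1 (by simp)
    unfold intrinsicPathDist
    refine le_iInf₂ fun σ hσ => ?_
    obtain ⟨hc, h0, h1, hm⟩ := hσ
    have hle : eVariationOn (P ∘ σ) (Set.Icc (0 : ℝ) 1) ≤ eVariationOn σ (Set.Icc (0 : ℝ) 1) := by
      simpa using (hL.lipschitzOnWith (s := Set.univ)).comp_eVariationOn_le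
        (Set.mapsTo_univ σ (Set.Icc (0 : ℝ) 1))
    refine le_trans (iInf₂_le (P ∘ σ) ?_) hle
    refine ⟨hL.continuous.comp_continuousOn hc, ?_, ?_, ?_⟩
    · simp [h0, hfix p hp]
    · simp [h1, hfix q hq]
    · exact fun t ht => hfr _ fun hi => (hm ht).2 (hsub hi)
  · exact iInf₂_le γ ⟨hγcont, hγ0, hγ1, hγQt⟩
end

section
/- Let E = EuclideanSpace ℝ (Fin 3), let S be a nonempty affine subspace of E, and let f : E ≃ᵢ E be an isometric equivalence fixing every point of S. Then for all points a, b ∈ S, every vector u ∈ E, and all real numbers s, t ≥ 0, one has dist (f (a + s • u)) (b + t • u) ≥ dist (a + s • u) (b + t • u). -/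
/-- Isosceles-trapezoid claim: if an isometry `f` of ℝ³ fixes every point of a nonempty
affine subspace `S`, then for points `a, b ∈ S`, any vector `u`, and nonnegative reals
`s, t`, moving the point `a + s • u` by `f` does not decrease its distance to `b + t • u`. -/
theorem isometry_fixing_affine_subspace_dist_ge
    (S : AffineSubspace ℝ (EuclideanSpace ℝ (Fin 3))) (hS : (S : Set (EuclideanSpace ℝ (Fin 3))).Nonempty)
    (f : EuclideanSpace ℝ (Fin 3) ≃ᵢ EuclideanSpace ℝ (Fin 3))
    (hf : ∀ x ∈ S, f x = x)
    (a b : EuclideanSpace ℝ (Fin 3)) (ha : a ∈ S) (hb : b ∈ S)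
    (u : EuclideanSpace ℝ (Fin 3)) (s t : ℝ) (hs : 0 ≤ s) (ht : 0 ≤ t) :
    dist (f (a + s • u)) (b + t • u) ≥ dist (a + s • u) (b + t • u) := by
  have h1 : dist (f (a + s • u)) a = dist (a + s • u) a := by
    conv_lhs => rw [← hf a ha]
    rw [f.dist_eq, hf a ha]
  have h2 : dist (f (a + s • u)) b = dist (a + s • u) b := by
    conv_lhs => rw [← hf b hb]
    rw [f.dist_eq]
  generalize f (a + s • u) = p at h1 h2 ⊢
  obtain ⟨v, rfl⟩ : ∃ v, p = a + v := ⟨p - a, by abel⟩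
  obtain ⟨w, rfl⟩ : ∃ w, a = b + w := ⟨a - b, by abel⟩
  have e1 : ‖v‖ = s * ‖u‖ := by
    simpa [dist_eq_norm, norm_smul, abs_of_nonneg hs] using h1
  have e2 : ‖w + v‖ = ‖w + s • u‖ := by
    simpa [dist_eq_norm, add_assoc] using h2
  have e3 : b + w + v - (b + t • u) = (w + v) - t • u := by abel
  have e4 : b + w + s • u - (b + t • u) = (w + s • u) - t • u := by abel
  rw [dist_eq_norm, dist_eq_norm, e3, e4, ge_iff_le]
  refine (sq_le_sq₀ (norm_nonneg _) (norm_nonneg _)).1 ?_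
  rw [norm_sub_sq_real, norm_sub_sq_real, e2]
  have c : inner ℝ v u ≤ s * (‖u‖ * ‖u‖) := by
    have := real_inner_le_norm v u
    rw [e1] at this
    linarith
  simp only [inner_add_left, inner_smul_left, inner_smul_right, real_inner_self_eq_norm_mul_norm,
    RCLike.conj_to_real]
  have := mul_le_mul_of_nonneg_left c ht
  linarith
end

section
/- Let G be a simple graph on a nonempty finite vertex type, and suppose G is a tree (connected and acyclic). Then there exist a vertex v and a closed walk w : G.Walk v v such that every edge of G occurs exactly twice in the list of edges of w and every vertex of G occurs in the support of w. -/
theorem tree_euler_tour_aux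
    {V : Type*} [Fintype V] [DecidableEq V]
    (G : SimpleGraph V) (hG : G.Connected) (n : ℕ) :
    ∀ (v : V) (w : G.Walk v v),
      (∀ e, w.edges.count e = 0 ∨ w.edges.count e = 2) →
      (Finset.univ \ w.support.toFinset).card ≤ n →
    ∃ (v : V) (w : G.Walk v v),
      (∀ e, w.edges.count e = 0 ∨ w.edges.count e = 2) ∧
      (∀ u : V, u ∈ w.support) := by
  induction n with
  | zero =>
    intro v w h1 h2
    refine ⟨v, w, h1, fun u => ?_⟩
    have h3 := Finset.card_eq_zero.mp (Nat.le_zero.mp h2)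
    by_contra hu
    have : u ∈ Finset.univ \ w.support.toFinset := by simp [hu]
    simp [h3] at this
  | succ n ih =>
    intro v w h1 h2
    by_cases hall : ∀ u : V, u ∈ w.support
    · exact ⟨v, w, h1, hall⟩
    push Not at hall
    obtain ⟨y, hy⟩ := hall
    obtain ⟨p⟩ := hG.preconnected v y
    obtain ⟨d, -, hd1, hd2⟩ := p.exists_boundary_dart {x | x ∈ w.support} (by simp) hy
    obtain ⟨⟨a, b⟩, hab⟩ := d
    simp only [Set.mem_setOf_eq] at hd1 hd2
    replace hab : G.Adj a b := hab
    have hperm : (w.rotate a hd1).edges.Perm w.edges := (w.rotate_edges a hd1).perm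
    refine ih a (SimpleGraph.Walk.cons hab (SimpleGraph.Walk.cons hab.symm (w.rotate a hd1))) ?_ ?_
    · intro e
      simp only [SimpleGraph.Walk.edges_cons, List.count_cons, hperm.count_eq]
      by_cases he : s(a, b) = e
      · subst he
        have : w.edges.count s(a, b) = 0 := List.count_eq_zero.mpr
          fun h => hd2 (w.snd_mem_support_of_mem_edges h)
        simp [this, Sym2.eq_swap]
      · have he' : s(b, a) ≠ e := by rwa [Sym2.eq_swap]
        simpa [he, he'] using h1 e
    · refine Nat.le_of_lt_succ (lt_of_lt_of_le (Finset.card_lt_card ?_) h2)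
      rw [Finset.ssubset_iff_of_subset]
      · exact ⟨b, by simp [hd2], by simp⟩
      · intro x hx
        simp at hx ⊢
        tauto

/-- Euler tour of a tree: every finite nonempty tree has a closed walk traversing each
edge exactly twice (once in each direction) and visiting every vertex. -/
theorem tree_euler_tour
    {V : Type*} [Fintype V] [Nonempty V] [DecidableEq V]
    (G : SimpleGraph V) (hG : G.IsTree) :
    ∃ (v : V) (w : G.Walk v v),
      (∀ e ∈ G.edgeSet, w.edges.count e = 2) ∧
      (∀ u : V, u ∈ w.support) := by
  obtain ⟨v, w, h1, h2⟩ := tree_euler_tour_aux G hG.connected _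
    (Classical.arbitrary V) SimpleGraph.Walk.nil (by simp) le_rfl
  refine ⟨v, w, fun e he => (h1 e).resolve_left fun h0 => ?_, h2⟩
  rw [List.count_eq_zero] at h0
  induction e with | _ a b
  have hb := SimpleGraph.isAcyclic_iff_forall_isBridge.mp hG.isAcyclic he
  have := SimpleGraph.isBridge_iff_forall_walk_mem_edges.mp hb
    ((w.takeUntil a (h2 a)).reverse.append (w.takeUntil b (h2 b)))
  simp only [SimpleGraph.Walk.edges_append, List.mem_append, SimpleGraph.Walk.edges_reverse,
    List.mem_reverse] at this
  rcases this with h | h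
  · exact h0 (w.edges_takeUntil_subset _ h)
  · exact h0 (w.edges_takeUntil_subset _ h)
end
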